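/- arXiv:2005.05172 — 2 statements merged into one kernel-verified Lean document; each statement's English description precedes it below -/
import Mathlib

section
/- Let F be a ν×ν real symmetric positive-semidefinite matrix whose entries satisfy |F_{kl}| ≤ r² for some r ≥ 0, let η > 0, and set A := (F + η·Id)⁻¹. Then (ν r² + η)⁻² ≤ Spc[A] ≤ η⁻², where Spc[A] := (Σ_{k,l=1}^ν A_{kl}²)/ν is the average of the squared singular values of A. -/
/-- The spectral quantity `Spc[A] := ‖A‖_F²/ν`, the average of the squared singular
values of the `ν×ν` matrix `A`. -/
noncomputable def Spc {ν : ℕ} (A : Matrix (Fin ν) (Fin ν) ℝ) : ℝ :=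
  (∑ k, ∑ l, (A k l) ^ 2) / ν

open Matrix in
/-- A left inverse of `F + η • 1`, with `F` positive semidefinite, has rows of Euclidean norm at
most `η⁻¹`. -/
lemma sum_sq_row_le_of_mul_eq_one {n : Type*} [Fintype n] [DecidableEq n]
    {F A : Matrix n n ℝ} (hF : F.PosSemidef) {η : ℝ} (hη : 0 < η)
    (hA : A * (F + η • (1 : Matrix n n ℝ)) = 1) (k : n) :
    ∑ l, A k l ^ 2 ≤ η⁻¹ ^ 2 := by
  set s := ∑ l, A k l ^ 2 with hs
  have hdot : A k ⬝ᵥ A k = s := by simp [dotProduct, hs, sq]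
  have hrow : A k ᵥ* (F + η • (1 : Matrix n n ℝ)) = (1 : Matrix n n ℝ) k :=
    congrFun hA k
  have hquad : A k ⬝ᵥ (F *ᵥ A k) + η * s = A k k := by
    calc A k ⬝ᵥ (F *ᵥ A k) + η * s
        = A k ⬝ᵥ ((F + η • (1 : Matrix n n ℝ)) *ᵥ A k) := by
          simp [add_mulVec, smul_mulVec, dotProduct_add, hdot]
      _ = A k k := by
          rw [dotProduct_mulVec, hrow]
          simp [dotProduct, one_apply]
  have hpos : 0 ≤ A k ⬝ᵥ (F *ᵥ A k) := by
    simpa using hF.dotProduct_mulVec_nonneg (A k)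
  have hs0 : 0 ≤ s := Finset.sum_nonneg fun l _ => sq_nonneg _
  have hdiag : A k k ^ 2 ≤ s :=
    Finset.single_le_sum (f := fun l => A k l ^ 2) (fun l _ => sq_nonneg _) (Finset.mem_univ k)
  have hsq : (η * s) ^ 2 ≤ s :=
    (pow_le_pow_left₀ (by positivity) (by linarith) 2).trans hdiag
  rcases hs0.eq_or_lt with h | h
  · rw [← h]; positivity
  · rw [inv_pow, le_inv_comm₀ h (by positivity), ← one_div, le_div_iff₀ h]
    nlinarith

/-- A left inverse of `F + η • 1`, where the entries of `F` are bounded by `c`, has rows of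
Euclidean norm at least `(card n * c + η)⁻¹`. -/
lemma le_sum_sq_row_of_mul_eq_one {n : Type*} [Fintype n] [DecidableEq n]
    {F A : Matrix n n ℝ} {c η : ℝ} (hF : ∀ k l, |F k l| ≤ c) (hη : 0 < η)
    (hA : A * (F + η • (1 : Matrix n n ℝ)) = 1) (k : n) :
    (Fintype.card n * c + η)⁻¹ ^ 2 ≤ ∑ l, A k l ^ 2 := by
  set M := F + η • (1 : Matrix n n ℝ)
  have hc : 0 ≤ c := (abs_nonneg _).trans (hF k k)
  have hcol : ∑ l, |M l k| ≤ Fintype.card n * c + η := by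
    calc ∑ l, |M l k| ≤ ∑ l, (c + if l = k then η else 0) := by
          refine Finset.sum_le_sum fun l _ => (abs_add_le _ _).trans (add_le_add (hF l k) ?_)
          by_cases h : l = k <;> simp [h, abs_of_pos hη]
      _ = Fintype.card n * c + η := by simp [Finset.sum_add_distrib]
  have hcolsq : ∑ l, M l k ^ 2 ≤ (Fintype.card n * c + η) ^ 2 := by
    calc ∑ l, M l k ^ 2 = ∑ l, |M l k| ^ 2 := by simp
      _ ≤ (∑ l, |M l k|) ^ 2 := Finset.sum_sq_le_sq_sum_of_nonneg fun l _ => abs_nonneg _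
      _ ≤ _ := pow_le_pow_left₀ (Finset.sum_nonneg fun l _ => abs_nonneg _) hcol 2
  have hone : ∑ l, A k l * M l k = 1 := by
    rw [← Matrix.mul_apply, hA, Matrix.one_apply_eq]
  have hCS := Finset.sum_mul_sq_le_sq_mul_sq Finset.univ (A k) (fun l => M l k)
  rw [hone, one_pow] at hCS
  have hs0 : 0 ≤ ∑ l, A k l ^ 2 := Finset.sum_nonneg fun l _ => sq_nonneg _
  rw [inv_pow, inv_le_iff_one_le_mul₀ (by positivity)]
  exact hCS.trans (mul_le_mul_of_nonneg_left hcolsq hs0)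

/-- third assertion of Lemma 3.
Let `F` be a real symmetric positive-semidefinite `ν×ν` matrix with `|F_{kl}| ≤ r²`,
`η > 0`, and `A := (F + η·Id)⁻¹`. Then `(ν r² + η)⁻² ≤ Spc[A] ≤ η⁻²`. -/
theorem spc_regularised_inverse_bounds
    {ν : ℕ} (hν : 0 < ν)
    (F : Matrix (Fin ν) (Fin ν) ℝ) (hF : F.PosSemidef)
    (r : ℝ) (hr : 0 ≤ r) (hFentry : ∀ k l, |F k l| ≤ r ^ 2)
    (η : ℝ) (hη : 0 < η) :
    ((ν : ℝ) * r ^ 2 + η)⁻¹ ^ 2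
        ≤ Spc (F + η • (1 : Matrix (Fin ν) (Fin ν) ℝ))⁻¹ ∧
      Spc (F + η • (1 : Matrix (Fin ν) (Fin ν) ℝ))⁻¹ ≤ η⁻¹ ^ 2 := by
  have hunit : IsUnit (F + η • (1 : Matrix (Fin ν) (Fin ν) ℝ)).det :=
    (Matrix.isUnit_iff_isUnit_det _).mp
      (Matrix.PosDef.posSemidef_add hF (Matrix.PosDef.one.smul hη)).isUnit
  have hA := Matrix.nonsing_inv_mul _ hunit
  have hν' : (0 : ℝ) < ν := Nat.cast_pos.mpr hν
  unfold Spc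
  rw [le_div_iff₀ hν', div_le_iff₀ hν']
  constructor
  · simpa [mul_comm] using Finset.card_nsmul_le_sum Finset.univ _ _
      fun k _ => le_sum_sq_row_of_mul_eq_one hFentry hη hA k
  · simpa [mul_comm] using Finset.sum_le_card_nsmul Finset.univ _ _
      fun k _ => sum_sq_row_le_of_mul_eq_one hF hη hA k
end

section
/- Let A be a ν×ν real matrix, g ∈ ℝ^ν, and let ε > 0, f_F > 0, S > 0. Define a_{αβ} := Σ_{k,l=1}^ν g_l² A_{kα}² A_{lβ}² and b_k := Σ_{l=1}^ν A_{kl}². Suppose N_F > 0 and N_g > 0 are real numbers satisfying N_F ≥ 2 ε⁻² ν² ‖g‖_∞² ‖A‖_F⁴ f_F and N_g ≥ 2 ε⁻² ν ‖A‖_F² S, and suppose the per-entry variances satisfy 0 ≤ V_{αβ} ≤ ν² f_F / N_F for all α, β and 0 ≤ W_k ≤ ν S / N_g for all k. Then Σ_{α,β=1}^ν a_{αβ} V_{αβ} + Σ_{k=1}^ν b_k W_k ≤ ε². -/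
/-- The coefficients `∑_{k,l} g_l² A_{kα}² A_{lβ}²` sum to at most `‖g‖_∞² ‖A‖_F⁴`. -/
theorem sum_sq_mul_sq_mul_sq_le {ι : Type*} [Fintype ι] (A : Matrix ι ι ℝ) (g : ι → ℝ) :
    ∑ α, ∑ β, ∑ k, ∑ l, (g l) ^ 2 * (A k α) ^ 2 * (A l β) ^ 2
      ≤ ‖g‖ ^ 2 * (∑ k, ∑ l, (A k l) ^ 2) ^ 2 := by
  have hg (l : ι) : g l ^ 2 ≤ ‖g‖ ^ 2 := by
    simpa using pow_le_pow_left₀ (norm_nonneg _) (norm_le_pi_norm g l) 2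
  calc ∑ α, ∑ β, ∑ k, ∑ l, (g l) ^ 2 * (A k α) ^ 2 * (A l β) ^ 2
      ≤ ∑ α, ∑ β, ∑ k, ∑ l, ‖g‖ ^ 2 * (A k α) ^ 2 * (A l β) ^ 2 := by
        gcongr ∑ α, ∑ β, ∑ k, ∑ l, ?_ * _ * _ with α _ β _ k _ l _
        exact hg l
    _ = ‖g‖ ^ 2 * ((∑ α, ∑ k, (A k α) ^ 2) * ∑ β, ∑ l, (A l β) ^ 2) := by
        simp only [Finset.sum_mul_sum]
        simp only [Finset.mul_sum, mul_assoc]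
    _ = ‖g‖ ^ 2 * (∑ k, ∑ l, (A k l) ^ 2) ^ 2 := by
        rw [Finset.sum_comm (f := fun α k => A k α ^ 2), sq (∑ k, ∑ l, A k l ^ 2)]

/-- A total weight `x` times a variance bound `c / N` is at most `ε² / 2` once
`N ≥ 2 ε⁻² x c`. -/
theorem mul_div_le_half_sq {ε x c N : ℝ} (hε : 0 < ε) (hN : 0 < N)
    (h : 2 * ε⁻¹ ^ 2 * (x * c) ≤ N) : x * (c / N) ≤ ε ^ 2 / 2 := by
  rw [← mul_div_assoc, div_le_iff₀ hN]
  calc x * c = ε ^ 2 / 2 * (2 * ε⁻¹ ^ 2 * (x * c)) := by field_simp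
    _ ≤ ε ^ 2 / 2 * N := by gcongr

/-- quantitative content of Theorem 1.
With the error-propagation coefficients `a_{αβ} := ∑_{k,l} g_l² A_{kα}² A_{lβ}²` and
`b_k := ∑_l A_{kl}²`, if the sample numbers satisfy
`N_F ≥ 2 ε⁻² ν² ‖g‖_∞² ‖A‖_F⁴ f_F` and `N_g ≥ 2 ε⁻² ν ‖A‖_F² S`, and the per-entry
variances satisfy `0 ≤ V_{αβ} ≤ ν² f_F / N_F` and `0 ≤ W_k ≤ ν S / N_g`, then the
propagated shot-noise error `∑ a_{αβ} V_{αβ} + ∑ b_k W_k` is at most `ε²`.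
(For `g : Fin ν → ℝ`, the Pi-norm `‖g‖` is the sup norm `‖g‖_∞`.) -/
theorem theorem1_sampling_bound
    {ν : ℕ} (A : Matrix (Fin ν) (Fin ν) ℝ) (g : Fin ν → ℝ)
    (ε fF S : ℝ) (hε : 0 < ε) (hfF : 0 < fF) (hS : 0 < S)
    (NF Ng : ℝ) (hNF : 0 < NF) (hNg : 0 < Ng)
    (hNFbound : NF ≥ 2 * ε⁻¹ ^ 2 * (ν : ℝ) ^ 2 * ‖g‖ ^ 2
        * (∑ k, ∑ l, (A k l) ^ 2) ^ 2 * fF)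
    (hNgbound : Ng ≥ 2 * ε⁻¹ ^ 2 * (ν : ℝ) * (∑ k, ∑ l, (A k l) ^ 2) * S)
    (V : Matrix (Fin ν) (Fin ν) ℝ) (W : Fin ν → ℝ)
    (hV : ∀ α β, 0 ≤ V α β ∧ V α β ≤ (ν : ℝ) ^ 2 * fF / NF)
    (hW : ∀ k, 0 ≤ W k ∧ W k ≤ (ν : ℝ) * S / Ng) :
    (∑ α, ∑ β, (∑ k, ∑ l, (g l) ^ 2 * (A k α) ^ 2 * (A l β) ^ 2) * V α β)
      + (∑ k, (∑ l, (A k l) ^ 2) * W k) ≤ ε ^ 2 := by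
  have hF : ∑ α, ∑ β, (∑ k, ∑ l, (g l) ^ 2 * (A k α) ^ 2 * (A l β) ^ 2) * V α β
      ≤ ε ^ 2 / 2 :=
    calc _ ≤ ∑ α, ∑ β, (∑ k, ∑ l, (g l) ^ 2 * (A k α) ^ 2 * (A l β) ^ 2)
            * ((ν : ℝ) ^ 2 * fF / NF) := by
          gcongr with α _ β _
          exact (hV α β).2
      _ ≤ ‖g‖ ^ 2 * (∑ k, ∑ l, (A k l) ^ 2) ^ 2 * ((ν : ℝ) ^ 2 * fF / NF) := by
          simp only [← Finset.sum_mul]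
          gcongr
          exact sum_sq_mul_sq_mul_sq_le A g
      _ ≤ ε ^ 2 / 2 := mul_div_le_half_sq hε hNF (by linarith)
  have hG : ∑ k, (∑ l, (A k l) ^ 2) * W k ≤ ε ^ 2 / 2 :=
    calc _ ≤ ∑ k, (∑ l, (A k l) ^ 2) * ((ν : ℝ) * S / Ng) := by
          gcongr with k _
          exact (hW k).2
      _ = (∑ k, ∑ l, (A k l) ^ 2) * ((ν : ℝ) * S / Ng) := by rw [Finset.sum_mul]
      _ ≤ ε ^ 2 / 2 := mul_div_le_half_sq hε hNg (by linarith)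
  linarith
end
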